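/- arXiv:1412.5473 — 6 statements merged into one kernel-verified Lean document; each statement's English description precedes it below -/
import Mathlib

section
/- Let (C, (F_i)_{i∈I}) be a finitely connected Galois category whose terminal object t decomposes as t ≅ e_1 ⨿ ⋯ ⨿ e_d with each e_k connected. Then there is an injective map σ : {1,…,d} → I such that for each k, F_{σ(k)}(e_k) is a singleton and F_{σ(k)}(e_j) is empty for every j ≠ k with 1 ≤ j ≤ d. -/
open CategoryTheory Limits PreGaloisCategory

universe u v w

/-- A functor to types preserving the terminal object and a coproduct decomposition of it has
at most one element in all the fibers of the summands taken together. -/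
lemma subsingleton_sigma_obj_of_isTerminal_sigma {C : Type u} [Category.{v} C] {ι : Type*}
    (e : ι → C) [HasCoproduct e] (ht : IsTerminal (∐ e)) (G : C ⥤ Type w)
    [PreservesLimit (Functor.empty.{0} C) G] [PreservesColimit (Discrete.functor e) G] :
    Subsingleton (Σ j, G.obj (e j)) := by
  have hc := (Cofan.nonempty_isColimit_iff_bijective_fromSigma _).1
    ⟨isColimitOfHasCoproductOfPreservesColimit G e⟩
  have : Subsingleton (G.obj (∐ e)) :=
    (Types.isTerminalEquivUnique _ (ht.isTerminalObj G)).instSubsingleton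
  exact ⟨fun x y => hc.injective (Subsingleton.elim (α := G.obj (∐ e)) _ _)⟩

/-- If a family of functors to finite types jointly reflects isomorphisms, then an
object which is not initial has a nonempty fiber under one of them. -/
lemma exists_nonempty_fiber_of_not_isInitial {C : Type u} [Category.{v} C] [HasInitial C]
    {I : Type*} (F : I → C ⥤ FintypeCat.{w})
    (hiso : ∀ {A B : C} (u : A ⟶ B), (∀ i, Function.Bijective ((F i).map u)) → IsIso u)
    (X : C) (hX : IsInitial X → False) : ∃ i, Nonempty ((F i).obj X) := by
  by_contra! h
  have : IsIso (initial.to X) := hiso _ fun i => by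
    have := h i
    have := Function.isEmpty ((F i).map (initial.to X))
    exact ⟨Function.injective_of_subsingleton _, isEmptyElim⟩
  exact hX (initialIsInitial.ofIso (asIso (initial.to X)))

/-- Let `(C, (F i)_{i ∈ I})` be a finitely connected Galois category whose
terminal object `t` decomposes as `t ≅ e 1 ⨿ ⋯ ⨿ e d` with each `e k` connected. Then there is
an injection `σ : Fin d → I` such that `F (σ k) (e k)` is a singleton and `F (σ k) (e j) = ∅`
for `j ≠ k`. -/
theorem exists_injection_separating_fiber_functors
    {C : Type u} [Category.{v} C] [PreGaloisCategory C] [HasFiniteColimits C]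
    {I : Type w} [Finite I] [Nonempty I] (F : I → C ⥤ FintypeCat.{v})
    [∀ i, PreservesFiniteLimits (F i)] [∀ i, PreservesFiniteColimits (F i)]
    (hiso : ∀ {A B : C} (u : A ⟶ B), IsIso u ↔ ∀ i, Function.Bijective ((F i).map u))
    (t : C) (ht : IsTerminal t) (d : ℕ) (e : Fin d → C)
    (he : ∀ k, IsConnected (e k)) (hdec : t ≅ ∐ e) :
    ∃ σ : Fin d → I, Function.Injective σ ∧
      (∀ k, Nonempty ((F (σ k)).obj (e k)) ∧ Subsingleton ((F (σ k)).obj (e k))) ∧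
      (∀ k j, j ≠ k → IsEmpty ((F (σ k)).obj (e j))) := by
  choose σ hσ using fun k =>
    exists_nonempty_fiber_of_not_isInitial F (fun u => (hiso u).2) (e k) (he k).notInitial
  have hsub (i : I) : Subsingleton (Σ j, (F i).obj (e j)) :=
    subsingleton_sigma_obj_of_isTerminal_sigma e (ht.ofIso hdec) (F i ⋙ FintypeCat.incl)
  have hempty (k j : Fin d) (hjk : j ≠ k) : IsEmpty ((F (σ k)).obj (e j)) :=
    ⟨fun x => hjk (congrArg Sigma.fst ((hsub (σ k)).elim ⟨j, x⟩ ⟨k, (hσ k).some⟩))⟩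
  refine ⟨σ, fun j k hjk => ?_, fun k => ⟨hσ k, ⟨fun x y => ?_⟩⟩, hempty⟩
  · by_contra hne
    exact (hempty k j hne).false (hjk ▸ (hσ j).some)
  · exact sigma_mk_injective (β := fun j => (F (σ k)).obj (e j))
      ((hsub (σ k)).elim ⟨k, x⟩ ⟨k, y⟩)
end

section
/- Let (C, (F_i)_{i∈I}) be a finitely connected Galois category whose terminal object decomposes as t ≅ e_1 ⨿ ⋯ ⨿ e_d with each e_k connected, and let σ : {1,…,d} → I be an injection with F_{σ(k)}(e_k) a singleton and F_{σ(k)}(e_j) empty for j ≠ k. Then for every i ∈ I there is exactly one k ∈ {1,…,d} such that F_i is naturally isomorphic to F_{σ(k)}. -/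
open CategoryTheory Limits PreGaloisCategory

universe u v w

section FiberFunctors

variable {D : Type u} [Category.{v} D] [GaloisCategory D]

/-- Since `F` is pro-represented by its pointed Galois objects, a compatible family of points in
the fibers of `G` over these objects induces a transformation `F ⟶ G`. -/
lemma nonempty_natTrans_of_fiberFunctor (F G : D ⥤ FintypeCat.{v}) [FiberFunctor F]
    [FiberFunctor G] : Nonempty (F ⟶ G) := by
  let K : PointedGaloisObject F ⥤ Type v := PointedGaloisObject.incl F ⋙ G ⋙ FintypeCat.incl
  have (A : PointedGaloisObject F) : Finite (K.obj A) :=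
    inferInstanceAs (Finite (G.obj A.obj))
  have (A : PointedGaloisObject F) : Nonempty (K.obj A) :=
    inferInstanceAs (Nonempty (G.obj A.obj))
  obtain ⟨s, hs⟩ := nonempty_sections_of_finite_cofiltered_system K
  let c : Cocone ((PointedGaloisObject.incl F).op ⋙ coyoneda) :=
    { pt := G ⋙ FintypeCat.incl
      ι :=
        { app A :=
            { app X := ↾fun (f : A.unop.obj ⟶ X) ↦ (G.map f (s A.unop) : G.obj X)
              naturality X Y g := by
                ext (f : A.unop.obj ⟶ X)
                exact ConcreteCategory.congr_hom (G.map_comp f g) (s A.unop) }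
          naturality A B f := by
            ext X (g : A.unop.obj ⟶ X)
            have h : G.map f.unop.val (s B.unop) = s A.unop := hs f.unop
            change G.map (f.unop.val ≫ g) (s B.unop) = G.map g (s A.unop)
            rw [← h]
            exact ConcreteCategory.congr_hom (G.map_comp f.unop.val g) (s B.unop) } }
  let α : F ⋙ FintypeCat.incl ⟶ G ⋙ FintypeCat.incl := (PointedGaloisObject.isColimit F).desc c
  exact ⟨((Functor.FullyFaithful.ofFullyFaithful FintypeCat.incl).whiskeringRight D).preimage α⟩

lemma injective_app_of_fiberFunctor {F G : D ⥤ FintypeCat.{v}} [FiberFunctor F]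
    [FiberFunctor G] (α : F ⟶ G) (X : D) : Function.Injective (α.app X) := by
  obtain ⟨A, a, _, h⟩ := exists_galois_representative F X
  refine Function.Injective.of_comp_right (g := fun f : A ⟶ X ↦ F.map f a) ?_ h.surjective
  convert evaluation_injective_of_isConnected G A X (α.app A a) using 1
  ext f
  exact NatTrans.naturality_apply α f a

theorem nonempty_iso_of_fiberFunctor (F G : D ⥤ FintypeCat.{v}) [FiberFunctor F]
    [FiberFunctor G] : Nonempty (F ≅ G) := by
  obtain ⟨α⟩ := nonempty_natTrans_of_fiberFunctor F G
  obtain ⟨β⟩ := nonempty_natTrans_of_fiberFunctor G F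
  have (X : D) : IsIso (α.app X) := by
    rw [ConcreteCategory.isIso_iff_bijective]
    exact (injective_app_of_fiberFunctor α X).bijective_of_nat_card_le
      (Nat.card_le_card_of_injective _ (injective_app_of_fiberFunctor β X))
  have : IsIso α := NatIso.isIso_of_isIso_app α
  exact ⟨asIso α⟩

end FiberFunctors

lemma FintypeCat.nonempty_unique_of_isTerminal {X : FintypeCat.{w}} (h : IsTerminal X) :
    Nonempty (Unique X) :=
  ⟨{ default := h.from (FintypeCat.of PUnit) PUnit.unit
     uniq a := ConcreteCategory.congr_hom
      (h.hom_ext (FintypeCat.homMk fun _ : X ↦ a) (FintypeCat.homMk fun _ ↦ _)) a }⟩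

section Exact

variable {C : Type u} [Category.{v} C] (F : C ⥤ FintypeCat.{w})

lemma exists_of_isPullback_fiber [PreservesFiniteLimits F] {P X Y Z : C} {fst : P ⟶ X}
    {snd : P ⟶ Y} {f : X ⟶ Z} {g : Y ⟶ Z} (sq : IsPullback fst snd f g) (x : F.obj X)
    (y : F.obj Y) (h : F.map f x = F.map g y) :
    ∃ p : F.obj P, F.map fst p = x ∧ F.map snd p = y :=
  Types.exists_of_isPullback (sq.map (F ⋙ FintypeCat.incl)) x y h

lemma isEmpty_fiber_of_isInitial [PreservesFiniteColimits F] {X : C} (h : IsInitial X) :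
    IsEmpty (F.obj X) :=
  (Concrete.initial_iff_empty_of_preserves_of_reflects (F.obj X)).mp ⟨h.isInitialObj F⟩

instance preservesColimitsOfShape_singleObj [PreservesFiniteColimits F] (G : Type*) [Group G]
    [Finite G] : PreservesColimitsOfShape (SingleObj G) F := by
  obtain ⟨G', hg, hf, ⟨e⟩⟩ := Finite.exists_type_univ_nonempty_mulEquiv.{_, 0} G
  have := Fintype.ofFinite G'
  exact preservesColimitsOfShape_of_equiv e.toSingleObjEquiv.symm F

lemma isIso_map_terminal_from [PreservesFiniteLimits F] [HasTerminal C] (e : C)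
    [Nonempty (F.obj e)] [Subsingleton (F.obj e)] : IsIso (F.map (terminal.from e)) := by
  obtain ⟨_⟩ := FintypeCat.nonempty_unique_of_isTerminal
    (terminalIsTerminal.isTerminalObj F)
  rw [ConcreteCategory.isIso_iff_bijective]
  exact ⟨Function.injective_of_subsingleton _, Function.surjective_to_subsingleton _⟩

lemma isIso_map_prod_snd [PreservesFiniteLimits F] [HasFiniteLimits C] (e X : C)
    [Nonempty (F.obj e)] [Subsingleton (F.obj e)] : IsIso (F.map (prod.snd : e ⨯ X ⟶ X)) :=
  have := isIso_map_terminal_from F e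
  ((IsPullback.of_hasBinaryProduct' e X).map F).isIso_snd_of_isIso

end Exact

section Slice

variable {C : Type u} [Category.{v} C] [PreGaloisCategory C] (e : C)

instance over_preGaloisCategory [HasFiniteColimits C] : PreGaloisCategory (Over e) where
  hasTerminal := inferInstance
  hasPullbacks := inferInstance
  hasFiniteCoproducts := inferInstance
  hasQuotientsByFiniteGroups _ _ _ := inferInstance
  monoInducesIsoOnDirectSummand {X Y} i _ := by
    obtain ⟨Z, u, ⟨h⟩⟩ := monoInducesIsoOnDirectSummand i.left
    let u' : Over.mk (u ≫ Y.hom) ⟶ Y := Over.homMk u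
    exact ⟨Over.mk (u ≫ Y.hom), u', ⟨isColimitOfReflects (Over.forget e)
      ((isColimitMapCoconeBinaryCofanEquiv (Over.forget e) i u').symm h)⟩⟩

end Slice

section Family

variable {C : Type u} [Category.{v} C] [PreGaloisCategory C] {I : Type w}
  {F : I → C ⥤ FintypeCat.{v}}

lemma nonempty_isInitial_of_isEmpty_fiber [∀ i, PreservesFiniteColimits (F i)]
    (hF : ∀ {A B : C} (f : A ⟶ B), (∀ i, Function.Bijective ((F i).map f)) → IsIso f) {X : C}
    (h : ∀ i, IsEmpty ((F i).obj X)) : Nonempty (IsInitial X) := by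
  have : IsIso (initial.to X) := hF _ fun i ↦
    have := h i
    have := isEmpty_fiber_of_isInitial (F i) (initialIsInitial (C := C))
    ⟨Function.injective_of_subsingleton _, fun x ↦ isEmptyElim x⟩
  exact ⟨initialIsInitial.ofIso (asIso (initial.to X))⟩

lemma mono_of_injective_fiber [∀ i, PreservesFiniteLimits (F i)]
    (hF : ∀ {A B : C} (f : A ⟶ B), (∀ i, Function.Bijective ((F i).map f)) → IsIso f) {X Y : C}
    (f : X ⟶ Y) (h : ∀ i, Function.Injective ((F i).map f)) : Mono f := by
  have : IsIso (pullback.fst f f) := hF _ fun i ↦ by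
    have : Mono ((F i).map f) := ConcreteCategory.mono_of_injective _ (h i)
    rw [← ConcreteCategory.isIso_iff_bijective]
    exact ((IsPullback.of_hasPullback f f).map (F i)).isIso_fst_of_mono
  exact (pullback.diagonal_isKernelPair f).mono_of_isIso_fst

variable [HasFiniteColimits C] [∀ i, PreservesFiniteLimits (F i)]
  [∀ i, PreservesFiniteColimits (F i)]

lemma nonempty_isInitial_of_hom_connected
    (hF : ∀ {A B : C} (f : A ⟶ B), (∀ i, Function.Bijective ((F i).map f)) → IsIso f) {e : C}
    [PreGaloisCategory.IsConnected e] (he : ∀ j, Subsingleton ((F j).obj e)) (i : I)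
    [Nonempty ((F i).obj e)] {X : C} (f : X ⟶ e) (hX : IsEmpty ((F i).obj X)) :
    Nonempty (IsInitial X) := by
  let p := pullback.fst f f
  let q := pullback.snd f f
  let π : X ⟶ coequalizer p q := coequalizer.π p q
  have hπ (j : I) : Function.Surjective ((F j).map π) :=
    surjective_of_epi (FintypeCat.incl.map ((F j).map π))
  let m : coequalizer p q ⟶ e := coequalizer.desc f pullback.condition
  have : Mono m := mono_of_injective_fiber hF m fun j ↦ by
    intro a b _
    obtain ⟨a, rfl⟩ := hπ j a
    obtain ⟨b, rfl⟩ := hπ j b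
    obtain ⟨c, rfl, rfl⟩ := exists_of_isPullback_fiber (F j) (IsPullback.of_hasPullback f f) a b
      (Subsingleton.elim _ _)
    have := ConcreteCategory.congr_hom ((F j).congr_map (coequalizer.condition p q)) c
    simpa using this
  by_cases h : Nonempty (IsInitial (coequalizer p q))
  · refine nonempty_isInitial_of_isEmpty_fiber hF fun j ↦ ?_
    have := isEmpty_fiber_of_isInitial (F j) h.some
    exact Function.isEmpty ((F j).map π)
  · have : IsIso m := IsConnected.noTrivialComponent _ m fun h' ↦ h ⟨h'⟩
    obtain ⟨x⟩ := ‹Nonempty ((F i).obj e)›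
    obtain ⟨y, -⟩ := hπ i ((F i).map (inv m) x)
    exact hX.elim y

lemma isIso_of_mono_of_surjective_fiber
    (hF : ∀ {A B : C} (f : A ⟶ B), (∀ i, Function.Bijective ((F i).map f)) → IsIso f) {e : C}
    [PreGaloisCategory.IsConnected e] (he : ∀ j, Subsingleton ((F j).obj e)) (i : I)
    [Nonempty ((F i).obj e)] {X Y : C} (f : X ⟶ Y) [Mono f] (g : Y ⟶ e)
    (hf : Function.Surjective ((F i).map f)) : IsIso f := by
  obtain ⟨Z, v, ⟨h⟩⟩ := monoInducesIsoOnDirectSummand f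
  have hc := (Types.binaryCofan_isColimit_iff _).mp ⟨(isColimitMapCoconeBinaryCofanEquiv
    (F i ⋙ FintypeCat.incl) f v) (isColimitOfPreserves (F i ⋙ FintypeCat.incl) h)⟩
  have hZ : IsEmpty ((F i).obj Z) := ⟨fun z ↦ by
    obtain ⟨x, hx⟩ := hf ((F i).map v z)
    exact Set.disjoint_left.mp hc.2.2.disjoint ⟨x, hx⟩ ⟨z, rfl⟩⟩
  obtain ⟨hZ⟩ := nonempty_isInitial_of_hom_connected hF he i (v ≫ g) hZ
  exact (BinaryCofan.isColimit_iff_isIso_inl hZ _).mp ⟨h⟩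

lemma isIso_of_bijective_fiber
    (hF : ∀ {A B : C} (f : A ⟶ B), (∀ i, Function.Bijective ((F i).map f)) → IsIso f) {e : C}
    [PreGaloisCategory.IsConnected e] (he : ∀ j, Subsingleton ((F j).obj e)) (i : I)
    [Nonempty ((F i).obj e)] {X Y : C} (f : X ⟶ Y) (g : Y ⟶ e)
    (hf : Function.Bijective ((F i).map f)) : IsIso f := by
  have : IsIso (pullback.diagonal f) := by
    refine isIso_of_mono_of_surjective_fiber hF he i _ (pullback.fst f f ≫ f ≫ g) ?_
    have : IsIso ((F i).map f) := (ConcreteCategory.isIso_iff_bijective _).mpr hf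
    have := ((IsPullback.of_hasPullback f f).map (F i)).isIso_fst_of_isIso
    have : IsIso ((F i).map (pullback.diagonal f)) := by
      refine @IsIso.of_isIso_comp_right _ _ _ _ _ _ ((F i).map (pullback.fst f f)) _ ?_
      rw [← Functor.map_comp, pullback.diagonal_fst]
      infer_instance
    exact ((ConcreteCategory.isIso_iff_bijective _).mp this).2
  have : Mono f := (pullback.isIso_diagonal_iff f).mp this
  exact isIso_of_mono_of_surjective_fiber hF he i f g hf.2

lemma fiberFunctor_over
    (hF : ∀ {A B : C} (f : A ⟶ B), (∀ i, Function.Bijective ((F i).map f)) → IsIso f) {e : C}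
    [PreGaloisCategory.IsConnected e] (he : ∀ j, Subsingleton ((F j).obj e)) (i : I)
    [Nonempty ((F i).obj e)] : Nonempty (FiberFunctor (Over.forget e ⋙ F i)) := by
  have : (Over.forget e ⋙ F i).ReflectsIsomorphisms := ⟨fun {X Y} f hf ↦ by
    have : IsIso ((Over.forget e).map f) := isIso_of_bijective_fiber hF he i f.left Y.hom
      ((ConcreteCategory.isIso_iff_bijective _).mp hf)
    exact isIso_of_reflects_iso f (Over.forget e)⟩
  have : PreservesLimitsOfShape (Discrete PEmpty.{1}) (Over.forget e ⋙ F i) := by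
    have : Subsingleton ((F i).obj e) := he i
    have : PreservesLimit (Functor.empty.{0} (Over e)) (Over.forget e ⋙ F i) := by
      refine preservesLimit_of_preserves_limit_cone Over.mkIdTerminal ?_
      have := isIso_map_terminal_from (F i) e
      refine (isLimitMapConeEmptyConeEquiv _ _).symm ?_
      exact (terminalIsTerminal.isTerminalObj (F i)).ofIso
        (asIso ((F i).map (terminal.from e))).symm
    exact preservesLimitsOfShape_pempty_of_preservesTerminal _
  exact ⟨{
    preservesQuotientsByFiniteGroups := fun G _ _ ↦
      have : PreservesColimitsOfShape (SingleObj G) (Over.forget e) :=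
        (Over.forgetAdjStar e).leftAdjoint_preservesColimits.preservesColimitsOfShape
      comp_preservesColimitsOfShape (Over.forget e) (F i) }⟩

/-- Two of the functors `F i` whose fibers at the connected object `e` are singletons restrict to
fiber functors on `Over e`, and they are recovered from these restrictions along
`X ↦ e ⨯ X`. -/
theorem nonempty_iso_of_nonempty_fiber
    (hF : ∀ {A B : C} (f : A ⟶ B), (∀ i, Function.Bijective ((F i).map f)) → IsIso f) {e : C}
    [PreGaloisCategory.IsConnected e] (he : ∀ j, Subsingleton ((F j).obj e)) (i j : I)
    [Nonempty ((F i).obj e)] [Nonempty ((F j).obj e)] : Nonempty (F i ≅ F j) := by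
  obtain ⟨_⟩ := fiberFunctor_over hF he i
  obtain ⟨_⟩ := fiberFunctor_over hF he j
  have : GaloisCategory (Over e) := ⟨_, ⟨‹FiberFunctor (Over.forget e ⋙ F i)›⟩⟩
  obtain ⟨α⟩ := nonempty_iso_of_fiberFunctor (Over.forget e ⋙ F i) (Over.forget e ⋙ F j)
  have key (k : I) [Nonempty ((F k).obj e)] :
      Nonempty (Over.star e ⋙ Over.forget e ⋙ F k ≅ F k) := by
    let β : Over.star e ⋙ Over.forget e ⋙ F k ⟶ F k :=
      Functor.whiskerRight (Over.forgetAdjStar e).counit (F k)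
    have (X : C) : IsIso (β.app X) := by
      have := he k
      have := isIso_map_prod_snd (F k) e X
      rwa [← Over.forgetAdjStar_counit_app] at this
    have : IsIso β := NatIso.isIso_of_isIso_app β
    exact ⟨asIso β⟩
  obtain ⟨a⟩ := key i
  obtain ⟨b⟩ := key j
  exact ⟨a.symm ≪≫ Functor.isoWhiskerLeft (Over.star e) α ≪≫ b⟩

end Family

section Decomposition

variable {C : Type u} [Category.{v} C] [HasFiniteCoproducts C] (F : C ⥤ FintypeCat.{w})
  [PreservesFiniteCoproducts F] {J : Type} [Finite J] (e : J → C)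

/-- The fiber of a coproduct is the disjoint union of the fibers. -/
noncomputable def isColimitMapCofan : IsColimit
    (Cofan.mk (F.obj (∐ e) : Type w) fun k ↦ FintypeCat.incl.map (F.map (Sigma.ι e k))) :=
  isColimitOfHasCoproductOfPreservesColimit (F ⋙ FintypeCat.incl) e

lemma exists_nonempty_fiber_of_sigma [Nonempty (F.obj (∐ e))] :
    ∃ k, Nonempty (F.obj (e k)) := by
  obtain ⟨x⟩ := ‹Nonempty (F.obj (∐ e))›
  obtain ⟨k, y, -⟩ := Cofan.inj_jointly_surjective_of_isColimit (isColimitMapCofan F e) x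
  exact ⟨k, ⟨y⟩⟩

lemma subsingleton_fiber_of_sigma [Subsingleton (F.obj (∐ e))] (k : J) :
    Subsingleton (F.obj (e k)) :=
  ⟨fun _ _ ↦ Cofan.inj_injective_of_isColimit (isColimitMapCofan F e) k
    (Subsingleton.elim (α := F.obj (∐ e)) _ _)⟩

end Decomposition

/-- Let `(C, (F i)_{i ∈ I})` be a finitely connected Galois category whose
terminal object decomposes as `t ≅ e 1 ⨿ ⋯ ⨿ e d` with each `e k` connected, and let
`σ : Fin d → I` be an injection such that `F (σ k) (e k)` is a singleton and `F (σ k) (e j)`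
is empty for `j ≠ k`. Then every `F i` is naturally isomorphic to exactly one of the
`F (σ k)`. -/
theorem exists_unique_iso_fiber_functor
    {C : Type u} [Category.{v} C] [PreGaloisCategory C] [HasFiniteColimits C]
    {I : Type w} [Finite I] [Nonempty I] (F : I → C ⥤ FintypeCat.{v})
    [∀ i, PreservesFiniteLimits (F i)] [∀ i, PreservesFiniteColimits (F i)]
    (hiso : ∀ {A B : C} (u : A ⟶ B), IsIso u ↔ ∀ i, Function.Bijective ((F i).map u))
    (t : C) (ht : IsTerminal t) (d : ℕ) (e : Fin d → C)
    (he : ∀ k, IsConnected (e k)) (hdec : t ≅ ∐ e)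
    (σ : Fin d → I) (hσ : Function.Injective σ)
    (hsing : ∀ k, Nonempty ((F (σ k)).obj (e k)) ∧ Subsingleton ((F (σ k)).obj (e k)))
    (hempty : ∀ k j, j ≠ k → IsEmpty ((F (σ k)).obj (e j)))
    (i : I) :
    ∃! k : Fin d, Nonempty (F i ≅ F (σ k)) := by
  have hF {A B : C} (f : A ⟶ B) (h : ∀ i, Function.Bijective ((F i).map f)) : IsIso f :=
    (hiso f).mpr h
  have hu (j : I) : Nonempty (Unique ((F j).obj (∐ e))) :=
    FintypeCat.nonempty_unique_of_isTerminal ((ht.ofIso hdec).isTerminalObj (F j))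
  have hs (k : Fin d) (j : I) : Subsingleton ((F j).obj (e k)) := by
    obtain ⟨_⟩ := hu j
    exact subsingleton_fiber_of_sigma (F j) e k
  obtain ⟨k, hk⟩ : ∃ k, Nonempty ((F i).obj (e k)) := by
    obtain ⟨_⟩ := hu i
    exact exists_nonempty_fiber_of_sigma (F i) e
  have := he k
  have := (hsing k).1
  refine ⟨k, nonempty_iso_of_nonempty_fiber hF (hs k) i (σ k), ?_⟩
  rintro l ⟨α⟩
  by_contra hl
  have := hempty l k (Ne.symm hl)
  exact isEmptyElim (α.hom.app (e k) hk.some)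
end

section
/- Let (C, (F_i)_{i∈I}) be a finitely connected Galois category whose terminal object decomposes as t ≅ e_1 ⨿ ⋯ ⨿ e_d with each e_k connected, and let σ : {1,…,d} → I be an injection with F_{σ(k)}(e_k) a singleton and F_{σ(k)}(e_j) empty for j ≠ k. For each k let C_k be the full subcategory of C on objects X with F_{σ(j)}(X) empty for all j ≠ k. For an object X of C and each k, let X_k be the pullback of the unique morphism X → t along the coproduct inclusion e_k → t. Then X_k is an object of C_k, and the canonical morphism X_1 ⨿ ⋯ ⨿ X_d → X is an isomorphism. -/
open CategoryTheory Limits PreGaloisCategory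

universe u v w

/-- A category with pullbacks and finite coproducts is finitary extensive as soon as it admits a
jointly conservative family of functors to types which preserve finite limits and
finite colimits. -/
lemma finitaryExtensive_of_jointly_reflects_isomorphisms {C : Type u} [Category.{v} C]
    [HasPullbacks C] [HasFiniteCoproducts C] {I : Type w} (G : I → C ⥤ Type v)
    [∀ i, PreservesFiniteLimits (G i)] [∀ i, PreservesFiniteColimits (G i)]
    (hG : ∀ {A B : C} (f : A ⟶ B), (∀ i, IsIso ((G i).map f)) → IsIso f) :
    FinitaryExtensive C := by
  let H : C ⥤ Discrete I ⥤ Type v := (Discrete.functor G).flip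
  have : PreservesLimitsOfShape WalkingCospan H :=
    preservesLimitsOfShape_of_evaluation H _ fun i =>
      (inferInstance : PreservesLimitsOfShape WalkingCospan (G i.as))
  have : PreservesColimitsOfShape (Discrete WalkingPair) H :=
    preservesColimitsOfShape_of_evaluation H _ fun i =>
      (inferInstance : PreservesColimitsOfShape (Discrete WalkingPair) (G i.as))
  have : H.ReflectsIsomorphisms := ⟨fun f hf => hG f fun i =>
    (inferInstance : IsIso ((H.map f).app ⟨i⟩))⟩
  exact finitaryExtensive_of_preserves_and_reflects_isomorphism H

/-- Let `(C, (F i)_{i ∈ I})` be a finitely connected Galois category whose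
terminal object decomposes as `t ≅ e 1 ⨿ ⋯ ⨿ e d` with each `e k` connected, and let
`σ : Fin d → I` be an injection such that `F (σ k) (e k)` is a singleton and `F (σ k) (e j)`
is empty for `j ≠ k`. For an object `X` and each `k`, let `X_k` be the pullback of the unique
morphism `X ⟶ t` along the coproduct inclusion `e k ⟶ t`. Then `X_k` lies in `C_k` (i.e.
`F (σ j) X_k` is empty for all `j ≠ k`) and the canonical morphism `X_1 ⨿ ⋯ ⨿ X_d ⟶ X` is an
isomorphism. -/
theorem pullback_decomposition
    {C : Type u} [Category.{v} C] [PreGaloisCategory C] [HasFiniteColimits C]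
    {I : Type w} [Finite I] [Nonempty I] (F : I → C ⥤ FintypeCat.{v})
    [∀ i, PreservesFiniteLimits (F i)] [∀ i, PreservesFiniteColimits (F i)]
    (hiso : ∀ {A B : C} (u : A ⟶ B), IsIso u ↔ ∀ i, Function.Bijective ((F i).map u))
    (t : C) (ht : IsTerminal t) (d : ℕ) (e : Fin d → C)
    (he : ∀ k, IsConnected (e k)) (hdec : t ≅ ∐ e)
    (σ : Fin d → I) (hσ : Function.Injective σ)
    (hsing : ∀ k, Nonempty ((F (σ k)).obj (e k)) ∧ Subsingleton ((F (σ k)).obj (e k)))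
    (hempty : ∀ k j, j ≠ k → IsEmpty ((F (σ k)).obj (e j)))
    (X : C) :
    (∀ k j, j ≠ k →
      IsEmpty ((F (σ j)).obj (pullback (ht.from X) (Sigma.ι e k ≫ hdec.inv)))) ∧
    IsIso (Sigma.desc
      (fun k => pullback.fst (ht.from X) (Sigma.ι e k ≫ hdec.inv)) : _ ⟶ X) := by
  refine ⟨fun k j hjk => ?_, ?_⟩
  · have := hempty j k hjk.symm
    exact Function.isEmpty ((F (σ j)).map (pullback.snd (ht.from X) (Sigma.ι e k ≫ hdec.inv)))
  · have := finitaryExtensive_of_jointly_reflects_isomorphisms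
      (fun i => F i ⋙ FintypeCat.incl) fun u hu => (hiso u).2 fun i =>
        (isIso_iff_bijective _).1 (hu i)
    refine FinitaryPreExtensive.isIso_sigmaDesc_fst _ _ ?_
    have h : Sigma.desc (fun k => Sigma.ι e k ≫ hdec.inv) = hdec.inv := by ext; simp
    rw [h]
    infer_instance
end

section
/- Let G be a connected groupoid (a nonempty groupoid in which any two objects are isomorphic) and let x be an object of G. Then the functor category G ⥤ Type u is equivalent to the category of Aut(x)-sets, i.e. to the category Action (Type u) (Aut x) of types equipped with an action of the automorphism group of x. -/
open CategoryTheory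

universe u

/-- The functor from the one-object category on `Aut x` to `C` that hits `x`. -/
def CategoryTheory.Aut.singleObjFunctor {C : Type*} [Category* C] (x : C) :
    SingleObj (Aut x) ⥤ C where
  obj _ := x
  map f := Iso.hom (X := x) (Y := x) f

instance CategoryTheory.Aut.faithful_singleObjFunctor {C : Type*} [Category* C] (x : C) :
    (Aut.singleObjFunctor x).Faithful where
  map_injective h := Iso.ext h

instance CategoryTheory.Aut.full_singleObjFunctor {G : Type*} [Groupoid G] (x : G) :
    (Aut.singleObjFunctor x).Full where
  map_surjective f := ⟨(Groupoid.isoEquivHom x x).symm f, rfl⟩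

theorem CategoryTheory.Aut.isEquivalence_singleObjFunctor {G : Type*} [Groupoid G] (x : G)
    (h : ∀ y : G, Nonempty (x ≅ y)) : (Aut.singleObjFunctor x).IsEquivalence where
  essSurj := ⟨fun y => ⟨SingleObj.star _, h y⟩⟩

/-- Let `G` be a connected groupoid (nonempty, with any two objects
isomorphic) and let `x` be an object of `G`. Then the category of functors `G ⥤ Type u` is
equivalent to the category of `Aut x`-sets. -/
theorem functor_category_equiv_action
    (G : Type u) [Groupoid.{u} G] [Nonempty G]
    (hconn : ∀ a b : G, Nonempty (a ≅ b)) (x : G) :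
    Nonempty ((G ⥤ Type u) ≌ Action (Type u) (MonCat.of (Aut x))) := by
  have := Aut.isEquivalence_singleObjFunctor x (hconn x)
  exact ⟨(Aut.singleObjFunctor x).asEquivalence.congrLeft.symm.trans
    (Action.functorCategoryEquivalence (Type u) (Aut x)).symm⟩
end

section
/- Let C_1, …, C_n be (connected) Galois categories, let D be a (connected) Galois category, and let A : C_1 × ⋯ × C_n ⥤ D be a functor preserving finite limits and finite colimits. Then there exist an index i ∈ {1,…,n} and a functor B : C_i ⥤ D such that A is naturally isomorphic to p_i ⋙ B, where p_i : C_1 × ⋯ × C_n ⥤ C_i is the i-th projection functor. -/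
open CategoryTheory Limits PreGaloisCategory

universe u v w t

namespace CategoryTheory.PreGaloisCategory

/-- In a Galois category, initial objects are strict. -/
lemma nonempty_isInitial_of_hom {C : Type u} [Category.{v} C] [GaloisCategory C] {X Y : C}
    (f : X ⟶ Y) (hY : Nonempty (IsInitial Y)) : Nonempty (IsInitial X) := by
  let F := GaloisCategory.getFiberFunctor C
  rw [initial_iff_fiber_empty F] at hY ⊢
  exact ⟨fun x ↦ hY.false (F.map f x)⟩

/-- A natural transformation to an evaluation functor which is invertible in the diagonal case
and has initial sources otherwise. -/
lemma exists_natTrans_eval {ι : Type*} (C : ι → Type u) [∀ i, Category.{v} (C i)]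
    [∀ i, HasInitial (C i)] (i j : ι) :
    ∃ (J : C i ⥤ C j) (η : Pi.eval C i ⋙ J ⟶ Pi.eval C j),
      (i = j → ∀ X, IsIso (η.app X)) ∧ (i ≠ j → ∀ x, Nonempty (IsInitial (J.obj x))) := by
  by_cases h : i = j
  · subst h
    exact ⟨𝟭 _, (Functor.rightUnitor _).hom, fun _ _ ↦ inferInstance, fun h ↦ (h rfl).elim⟩
  · exact ⟨(Functor.const _).obj (⊥_ (C j)),
      { app X := initial.to _
        naturality _ _ _ := initialIsInitial.hom_ext _ _ },
      fun h' ↦ (h h').elim, fun _ _ ↦ ⟨initialIsInitial⟩⟩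

/-- A square whose two left-hand corners are initial is cartesian. -/
lemma isPullback_of_isInitial {C : Type u} [Category.{v} C] [GaloisCategory C] {P X Y Z : C}
    {f : P ⟶ X} {g : P ⟶ Y} {h : X ⟶ Z} {k : Y ⟶ Z}
    (hP : Nonempty (IsInitial P)) (hY : Nonempty (IsInitial Y)) : IsPullback f g h k where
  w := hP.some.hom_ext _ _
  isLimit' := ⟨PullbackCone.IsLimit.mk _ (fun s ↦ s.snd ≫ hY.some.to P)
    (fun s ↦ (nonempty_isInitial_of_hom s.snd hY).some.hom_ext _ _)
    (fun s ↦ (nonempty_isInitial_of_hom s.snd hY).some.hom_ext _ _)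
    (fun s _ _ _ ↦ (nonempty_isInitial_of_hom s.snd hY).some.hom_ext _ _)⟩

end CategoryTheory.PreGaloisCategory

lemma CategoryTheory.Pi.isPullback {ι : Type*} {C : ι → Type u} [∀ i, Category.{v} (C i)]
    {P X Y Z : ∀ i, C i} {f : P ⟶ X} {g : P ⟶ Y} {h : X ⟶ Z} {k : Y ⟶ Z}
    (H : ∀ i, IsPullback (f i) (g i) (h i) (k i)) : IsPullback f g h k where
  w := funext fun i ↦ (H i).w
  isLimit' := ⟨PullbackCone.IsLimit.mk _
    (fun s i ↦ (H i).lift (s.fst i) (s.snd i) (congrFun s.condition i))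
    (fun _ ↦ funext fun i ↦ (H i).lift_fst _ _ _)
    (fun _ ↦ funext fun i ↦ (H i).lift_snd _ _ _)
    (fun _ _ h₁ h₂ ↦ funext fun i ↦ (H i).hom_ext
      ((congrFun h₁ i).trans ((H i).lift_fst _ _ _).symm)
      ((congrFun h₂ i).trans ((H i).lift_snd _ _ _).symm))⟩

/-- Let `C 1, …, C n` (`n ≥ 1`) and `D` be (connected) Galois categories and
let `A : C 1 × ⋯ × C n ⥤ D` be a functor preserving finite limits and finite colimits. Then
there are an index `i` and a functor `B : C i ⥤ D` such that `A` is naturally isomorphic to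
`p i ⋙ B`, where `p i` is the `i`-th projection. -/
theorem factors_through_projection_of_exact
    {n : ℕ} (hn : 0 < n) (C : Fin n → Type u) [∀ i, Category.{v} (C i)]
    [∀ i, GaloisCategory (C i)]
    {D : Type w} [Category.{t} D] [GaloisCategory D]
    (A : (∀ i, C i) ⥤ D) [PreservesFiniteLimits A] [PreservesFiniteColimits A] :
    ∃ (i : Fin n) (B : C i ⥤ D), Nonempty (A ≅ Pi.eval C i ⋙ B) := by
  choose J η hη hJ using exists_natTrans_eval C
  let K (i : Fin n) : C i ⥤ ∀ j, C j := Functor.pi' (J i)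
  let ε (i : Fin n) (X : ∀ j, C j) : (K i).obj (X i) ⟶ X := fun j ↦ (η i j).app X
  have naturality (i : Fin n) {X Y : ∀ j, C j} (f : X ⟶ Y) :
      (K i).map (f i) ≫ ε i Y = ε i X ≫ f := funext fun j ↦ (η i j).naturality f
  have cart (i : Fin n) {X Y : ∀ j, C j} (f : X ⟶ Y) :
      IsPullback (ε i X) ((K i).map (f i)) f (ε i Y) := by
    refine Pi.isPullback fun j ↦ ?_
    by_cases h : i = j
    · have : IsIso (ε i X j) := hη i j h X
      have : IsIso (ε i Y j) := hη i j h Y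
      exact .of_horiz_isIso ⟨((η i j).naturality f).symm⟩
    · exact isPullback_of_isInitial (hJ i j h _) (hJ i j h _)
  obtain ⟨T, ⟨hT⟩⟩ : ∃ T : ∀ j, C j, Nonempty (IsTerminal T) :=
    ⟨fun j ↦ ⊤_ (C j), ⟨IsTerminal.ofUniqueHom (fun X j ↦ terminal.from (X j))
      fun X m ↦ funext fun j ↦ terminalIsTerminal.hom_ext _ _⟩⟩
  have hη' (j : Fin n) : IsIso ((η j j).app T) := hη j j rfl T
  let c : Cofan fun i ↦ (K i).obj (T i) := Cofan.mk T fun i ↦ ε i T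
  have hc : IsColimit c := Cofan.IsColimit.mk c
    (fun s j ↦ @inv _ _ _ _ ((η j j).app T) (hη' j) ≫ s.inj j j)
    (fun s i ↦ funext fun j ↦ by
      by_cases h : i = j
      · subst h
        exact IsIso.hom_inv_id_assoc ((η i i).app T) (s.inj i i)
      · exact (hJ i j h _).some.hom_ext _ _)
    (fun s m hm ↦ funext fun j ↦ (IsIso.eq_inv_comp ((η j j).app T)).2 (congrFun (hm j) j))
  let F := GaloisCategory.getFiberFunctor D
  have hFT : IsTerminal (F.obj (A.obj T)) := (hT.isTerminalObj A).isTerminalObj F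
  have : Unique (F.obj (A.obj T)) := Concrete.uniqueOfTerminalOfPreserves _ hFT
  obtain ⟨⟨i⟩, x, -⟩ := Concrete.isColimit_exists_rep _
    (isColimitOfPreserves F (isColimitOfPreserves A hc)) (default : F.obj (A.obj T))
  have hε : IsIso (A.map (ε i T)) := by
    have : Mono (ε i T) := ⟨fun {Z} g h H ↦ funext fun j ↦ by
      by_cases e : i = j
      · have : IsIso (ε i T j) := hη i j e T
        exact (cancel_mono (ε i T j)).1 (congrFun H j)
      · exact (nonempty_isInitial_of_hom (g j) (hJ i j e _)).some.hom_ext _ _⟩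
    have : IsIso (F.map (A.map (ε i T))) := by
      refine (ConcreteCategory.isIso_iff_bijective _).2
        ⟨ConcreteCategory.injective_of_mono_of_preservesPullback _,
          fun y ↦ ⟨x, Subsingleton.elim _ _⟩⟩
    exact isIso_of_reflects_iso _ F
  have hA (X : ∀ j, C j) : IsIso (A.map (ε i X)) :=
    ((cart i (hT.from X)).map A).isIso_fst_of_isIso
  refine ⟨i, K i ⋙ A, ⟨Iso.symm <| NatIso.ofComponents
    (fun X ↦ @asIso _ _ _ _ (A.map (ε i X)) (hA X)) fun f ↦ ?_⟩⟩
  exact (A.map_comp _ _).symm.trans ((congrArg A.map (naturality i f)).trans (A.map_comp _ _))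
end

section
/- Let D be a category with finite limits and finite colimits. Then any two functors F, G : FintypeCat ⥤ D which both preserve finite limits and finite colimits are naturally isomorphic. -/
open CategoryTheory Limits

universe u v w

namespace FintypeCat

/-- The morphism from the one-point set to `X` with value `x`. -/
def point {X : FintypeCat.{w}} (x : X) : of PUnit.{w + 1} ⟶ X :=
  homMk fun _ ↦ x

lemma point_comp {X Y : FintypeCat.{w}} (x : X) (f : X ⟶ Y) : point x ≫ f = point (f x) :=
  rfl

/-- The one-point set is terminal in `FintypeCat`. -/
def isTerminalPUnit : IsTerminal (of PUnit.{w + 1}) :=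
  IsTerminal.ofUniqueHom (fun _ ↦ homMk fun _ ↦ PUnit.unit) fun _ _ ↦ by ext

/-- The presentation of a finite set as the coproduct of its points. -/
def pointCofan (X : FintypeCat.{w}) : Cofan fun _ : X ↦ of PUnit.{w + 1} :=
  Cofan.mk X fun x ↦ point x

/-- A finite set is the coproduct of its points. -/
def isColimitPointCofan (X : FintypeCat.{w}) : IsColimit (pointCofan X) :=
  Cofan.IsColimit.mk _ (fun s ↦ homMk fun x ↦ s.inj x PUnit.unit)
    (fun _ _ ↦ rfl)
    (fun _ _ h ↦ by ext x; exact ConcreteCategory.congr_hom (h x) PUnit.unit)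

variable {D : Type u} [Category.{v} D]

/-- The image of a finite set under a functor preserving finite colimits is the coproduct of the
images of its points. -/
noncomputable def isColimitMapPointCofan (F : FintypeCat.{w} ⥤ D) [PreservesFiniteColimits F]
    (X : FintypeCat.{w}) :
    IsColimit (Cofan.mk (F.obj X) fun x : X ↦ F.map (point x)) :=
  isColimitCofanMkObjOfIsColimit F _ _ (isColimitPointCofan X)

lemma map_point_hom_ext (F : FintypeCat.{w} ⥤ D) [PreservesFiniteColimits F]
    {X : FintypeCat.{w}} {Z : D} {f g : F.obj X ⟶ Z}
    (h : ∀ x : X, F.map (point x) ≫ f = F.map (point x) ≫ g) : f = g :=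
  Cofan.IsColimit.hom_ext (isColimitMapPointCofan F X) _ _ h

/-- A functor preserving finite colimits maps to any other functor `G`, given a morphism between
the values at the one-point set. -/
noncomputable def natTransOfPoint (F G : FintypeCat.{w} ⥤ D) [PreservesFiniteColimits F]
    (φ : F.obj (of PUnit.{w + 1}) ⟶ G.obj (of PUnit.{w + 1})) : F ⟶ G where
  app X := Cofan.IsColimit.desc (isColimitMapPointCofan F X) fun x ↦ φ ≫ G.map (point x)
  naturality X Y f := map_point_hom_ext F fun x ↦ by
    have fac (Z : FintypeCat.{w}) (z : Z) := Cofan.IsColimit.fac (isColimitMapPointCofan F Z)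
      (fun z ↦ φ ≫ G.map (point z)) z
    dsimp at fac
    rw [← Category.assoc, ← F.map_comp, point_comp, fac, ← Category.assoc, fac, Category.assoc,
      ← G.map_comp, point_comp]

lemma map_point_natTransOfPoint_app (F G : FintypeCat.{w} ⥤ D) [PreservesFiniteColimits F]
    (φ : F.obj (of PUnit.{w + 1}) ⟶ G.obj (of PUnit.{w + 1})) {X : FintypeCat.{w}} (x : X) :
    F.map (point x) ≫ (natTransOfPoint F G φ).app X = φ ≫ G.map (point x) :=
  Cofan.IsColimit.fac (isColimitMapPointCofan F X) _ x

/-- Two functors preserving finite colimits are isomorphic if their values at the one-point set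
are isomorphic. -/
noncomputable def natIsoOfPoint (F G : FintypeCat.{w} ⥤ D) [PreservesFiniteColimits F]
    [PreservesFiniteColimits G]
    (e : F.obj (of PUnit.{w + 1}) ≅ G.obj (of PUnit.{w + 1})) : F ≅ G where
  hom := natTransOfPoint F G e.hom
  inv := natTransOfPoint G F e.inv
  hom_inv_id := by
    ext X
    exact map_point_hom_ext F fun x ↦ by
      rw [NatTrans.comp_app, ← Category.assoc, map_point_natTransOfPoint_app, Category.assoc,
        map_point_natTransOfPoint_app]
      simp
  inv_hom_id := by
    ext X
    exact map_point_hom_ext G fun x ↦ by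
      rw [NatTrans.comp_app, ← Category.assoc, map_point_natTransOfPoint_app, Category.assoc,
        map_point_natTransOfPoint_app]
      simp

end FintypeCat

/-- Let `D` be a category with finite limits and finite colimits. Then any
two functors `FintypeCat ⥤ D` preserving finite limits and finite colimits are naturally
isomorphic. -/
theorem exact_functors_from_fintypeCat_iso
    {D : Type u} [Category.{v} D] [HasFiniteLimits D] [HasFiniteColimits D]
    (F G : FintypeCat.{w} ⥤ D)
    [PreservesFiniteLimits F] [PreservesFiniteColimits F]
    [PreservesFiniteLimits G] [PreservesFiniteColimits G] :
    Nonempty (F ≅ G) :=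
  ⟨FintypeCat.natIsoOfPoint F G
    ((FintypeCat.isTerminalPUnit.isTerminalObj F).uniqueUpToIso
      (FintypeCat.isTerminalPUnit.isTerminalObj G))⟩
end
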